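/- Let Ω ⊆ ℝ^N be a Lebesgue-measurable set and p : Ω → ℝ a measurable function with 2 < p^- ≤ p^+ < ∞. Then the Nemytskii map u ↦ |u|^{p(·)−2}u is continuous from L^{p(·)}(Ω) to L^{p(·)/(p(·)−1)}(Ω): if (u_n) ⊂ L^{p(·)}(Ω), u ∈ L^{p(·)}(Ω) and |u_n − u|_{p(·)} → 0, then ||u_n|^{p(·)−2}u_n − |u|^{p(·)−2}u|_{p(·)/(p(·)−1)} → 0. -/

import Mathlib

open MeasureTheory Filter Topology

/-- The modular `ρ_{p(·)}(u) = ∫_Ω |u(x)|^{p(x)} dx` (as an extended nonnegative real);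
`u` belongs to `L^{p(·)}(Ω)` iff this is finite. -/
noncomputable def modular {N : ℕ} (Ω : Set (EuclideanSpace ℝ (Fin N)))
    (p u : EuclideanSpace ℝ (Fin N) → ℝ) : ENNReal :=
  ∫⁻ x in Ω, ENNReal.ofReal (|u x| ^ p x)

/-- The Luxemburg norm `|u|_{p(·)} = inf {α > 0 : ∫_Ω |u(x)/α|^{p(x)} dx ≤ 1}`. -/
noncomputable def luxNorm {N : ℕ} (Ω : Set (EuclideanSpace ℝ (Fin N)))
    (p u : EuclideanSpace ℝ (Fin N) → ℝ) : ℝ :=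
  sInf {α : ℝ | 0 < α ∧ (∫⁻ x in Ω, ENNReal.ofReal (|u x / α| ^ p x)) ≤ 1}

/-- The map `t ↦ |t|^(p-2) t` is locally Lipschitz, with a quantitative constant. -/
lemma abs_signedPow_sub_le {p : ℝ} (hp : 2 < p) (a b : ℝ) :
    |(|a| ^ (p - 2) * a - |b| ^ (p - 2) * b)| ≤
      (p - 1) * |a - b| * (|a| + |b|) ^ (p - 2) := by
  have hq : 0 < p - 2 := by linarith
  have key : ∀ x y : ℝ, 0 ≤ y → y ≤ x →
      x ^ (p - 2) * x - y ^ (p - 2) * y ≤ (p - 1) * (x - y) * (x + y) ^ (p - 2) := by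
    intro x y hy hyx
    rcases hy.eq_or_lt with rfl | hy0
    · have h0 : 0 ≤ x ^ (p - 2) * x := by positivity
      simp only [sub_zero, add_zero, mul_zero]
      nlinarith
    have hx : 0 < x := hy0.trans_le hyx
    have hb := one_add_mul_self_le_rpow_one_add (s := y / x - 1) (p := p - 1)
      (by have : 0 < y / x := by positivity
          linarith) (by linarith)
    rw [add_sub_cancel, Real.div_rpow hy hx.le, show p - 1 = (p - 2) + 1 by ring,
      Real.rpow_add_one hy0.ne', Real.rpow_add_one hx.ne', le_div_iff₀ (by positivity)] at hb
    have e : (1 + (p - 2 + 1) * (y / x - 1)) * (x ^ (p - 2) * x)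
        = x ^ (p - 2) * x + (p - 1) * (y - x) * x ^ (p - 2) := by
      field_simp
      ring
    have hm : x ^ (p - 2) ≤ (x + y) ^ (p - 2) :=
      Real.rpow_le_rpow hx.le (by linarith) hq.le
    have hm' := mul_le_mul_of_nonneg_left hm
      (mul_nonneg (by linarith : 0 ≤ p - 1) (sub_nonneg.2 hyx))
    rw [e] at hb
    linarith
  have opp : ∀ x y : ℝ, 0 ≤ x → 0 ≤ y →
      x ^ (p - 2) * x + y ^ (p - 2) * y ≤ (p - 1) * (x + y) * (x + y) ^ (p - 2) := by
    intro x y hx hy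
    have h1 : x ^ (p - 2) ≤ (x + y) ^ (p - 2) := Real.rpow_le_rpow hx (by linarith) hq.le
    have h2 : y ^ (p - 2) ≤ (x + y) ^ (p - 2) := Real.rpow_le_rpow hy (by linarith) hq.le
    have h3 : 0 ≤ (x + y) * (x + y) ^ (p - 2) := by positivity
    nlinarith [mul_le_mul_of_nonneg_right h1 hx, mul_le_mul_of_nonneg_right h2 hy]
  have mono : ∀ x y : ℝ, 0 ≤ y → y ≤ x → y ^ (p - 2) * y ≤ x ^ (p - 2) * x := fun x y hy hyx =>
    mul_le_mul (Real.rpow_le_rpow hy hyx hq.le) hyx hy (Real.rpow_nonneg (hy.trans hyx) _)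
  have same : ∀ x y : ℝ, 0 ≤ x → 0 ≤ y →
      |x ^ (p - 2) * x - y ^ (p - 2) * y| ≤ (p - 1) * |x - y| * (x + y) ^ (p - 2) := by
    intro x y hx hy
    rcases le_total y x with h | h
    · rw [abs_of_nonneg (sub_nonneg.2 (mono x y hy h)), abs_of_nonneg (sub_nonneg.2 h)]
      exact key x y hy h
    · rw [abs_sub_comm, abs_sub_comm x, add_comm x,
        abs_of_nonneg (sub_nonneg.2 (mono y x hx h)), abs_of_nonneg (sub_nonneg.2 h)]
      exact key y x hx h
  rcases le_total 0 a with ha | ha <;> rcases le_total 0 b with hb | hb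
  · rw [abs_of_nonneg ha, abs_of_nonneg hb]
    exact same a b ha hb
  · have h := opp a (-b) ha (by linarith)
    have h0 : 0 ≤ a ^ (p - 2) * a := by positivity
    have h1 : 0 ≤ (-b) ^ (p - 2) * (-b) :=
      mul_nonneg (Real.rpow_nonneg (by linarith) _) (by linarith)
    rw [abs_of_nonneg ha, abs_of_nonpos hb, abs_of_nonneg (a := a - b) (by linarith),
      abs_of_nonneg (by linarith)]
    rw [← sub_eq_add_neg] at h ⊢
    linarith
  · have h := opp (-a) b (by linarith) hb
    have h0 : 0 ≤ b ^ (p - 2) * b := by positivity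
    have h1 : 0 ≤ (-a) ^ (p - 2) * (-a) :=
      mul_nonneg (Real.rpow_nonneg (by linarith) _) (by linarith)
    rw [abs_of_nonpos ha, abs_of_nonneg hb, abs_of_nonpos (a := a - b) (by linarith),
      abs_of_nonpos (by linarith)]
    rw [show -(a - b) = -a + b by ring]
    linarith
  · have h := same (-a) (-b) (by linarith) (by linarith)
    rw [abs_of_nonpos ha, abs_of_nonpos hb, ← abs_neg, ← abs_neg (a - b)]
    convert h using 2 <;> ring_nf

lemma add_rpow_le_two_rpow_mul {p M x y : ℝ} (hp : 0 ≤ p) (hM : p ≤ M) (hx : 0 ≤ x)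
    (hy : 0 ≤ y) : (x + y) ^ p ≤ 2 ^ M * (x ^ p + y ^ p) := by
  have hmax : 0 ≤ max x y := hx.trans (le_max_left _ _)
  have h1 : (x + y) ^ p ≤ (2 * max x y) ^ p :=
    Real.rpow_le_rpow (by positivity)
      (by linarith [le_max_left x y, le_max_right x y]) hp
  have h2 : (max x y) ^ p ≤ x ^ p + y ^ p := by
    have := Real.rpow_nonneg hx p
    have := Real.rpow_nonneg hy p
    rcases max_choice x y with h | h <;> rw [h] <;> linarith
  calc (x + y) ^ p ≤ 2 ^ p * (max x y) ^ p := by rwa [← Real.mul_rpow (by norm_num) hmax]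
    _ ≤ 2 ^ M * (x ^ p + y ^ p) := by
      gcongr
      norm_num

/-- The pointwise estimate behind the continuity of the Nemytskii map. -/
lemma abs_signedPow_sub_rpow_conj_le {p M δ : ℝ} (hp : 2 < p) (hM : p ≤ M) (hδ : 0 < δ)
    (hδ1 : δ ≤ 1) (a b : ℝ) :
    |(|a| ^ (p - 2) * a - |b| ^ (p - 2) * b)| ^ (p / (p - 1)) ≤
      M ^ 2 * 4 ^ M * 2 ^ M * δ * |b| ^ p
        + (M ^ 2 * 4 ^ M * 2 ^ M + M ^ 2 * δ⁻¹ ^ M) * |a - b| ^ p := by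
  set d := |a - b| with hd
  set s := |a| + |b| with hs
  set r := p / (p - 1) with hr
  have hd0 : 0 ≤ d := abs_nonneg _
  have hs0 : 0 ≤ s := by positivity
  have hp1 : 0 < p - 1 := by linarith
  have hr1 : 1 ≤ r := by rw [hr, le_div_iff₀ hp1]; linarith
  have hr2 : r ≤ 2 := by rw [hr, div_le_iff₀ hp1]; linarith
  have hr0 : 0 ≤ r := by linarith
  have hpr : (p - 1) * r = p := by rw [hr]; field_simp
  have hK : (p - 1) ^ r ≤ M ^ 2 := by
    calc (p - 1) ^ r ≤ M ^ r := Real.rpow_le_rpow hp1.le (by linarith) hr0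
      _ ≤ M ^ (2 : ℝ) := Real.rpow_le_rpow_of_exponent_le (by linarith) hr2
      _ = M ^ 2 := Real.rpow_two M
  have hsplit : ∀ x : ℝ, 0 ≤ x → x * x ^ (p - 2) = x ^ (p - 1) := by
    intro x hx
    rw [show p - 1 = 1 + (p - 2) by ring, Real.rpow_add_of_nonneg hx (by norm_num) (by linarith),
      Real.rpow_one]
  have hlip := abs_signedPow_sub_le hp a b
  have hmain : |(|a| ^ (p - 2) * a - |b| ^ (p - 2) * b)| ^ r ≤
      M ^ 2 * δ * s ^ p + M ^ 2 * δ⁻¹ ^ M * d ^ p := by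
    rcases le_total d (δ * s) with h | h
    · have h1 : |(|a| ^ (p - 2) * a - |b| ^ (p - 2) * b)| ≤ (p - 1) * δ * s ^ (p - 1) := by
        rw [← hsplit s hs0]
        calc _ ≤ (p - 1) * d * s ^ (p - 2) := hlip
          _ ≤ (p - 1) * (δ * s) * s ^ (p - 2) := by gcongr
          _ = _ := by ring
      have h2 := Real.rpow_le_rpow (abs_nonneg _) h1 hr0
      rw [Real.mul_rpow (by positivity) (by positivity), Real.mul_rpow hp1.le hδ.le,
        ← Real.rpow_mul hs0, hpr] at h2
      have h3 : δ ^ r ≤ δ := by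
        simpa using Real.rpow_le_rpow_of_exponent_ge hδ hδ1 hr1
      calc _ ≤ _ := h2
        _ ≤ M ^ 2 * δ * s ^ p := by gcongr
        _ ≤ _ := le_add_of_nonneg_right (by positivity)
    · have hsd : s ≤ δ⁻¹ * d := by
        rw [inv_mul_eq_div, le_div_iff₀ hδ]; linarith
      have hinv : 1 ≤ δ⁻¹ := (one_le_inv₀ hδ).2 hδ1
      have hdd : d ≤ δ⁻¹ * d := le_mul_of_one_le_left hd0 hinv
      have h1 : |(|a| ^ (p - 2) * a - |b| ^ (p - 2) * b)| ≤ (p - 1) * (δ⁻¹ * d) ^ (p - 1) := by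
        rw [← hsplit _ (by positivity), ← mul_assoc]
        calc _ ≤ (p - 1) * d * s ^ (p - 2) := hlip
          _ ≤ _ := by gcongr
      have h2 := Real.rpow_le_rpow (abs_nonneg _) h1 hr0
      rw [Real.mul_rpow hp1.le (by positivity), ← Real.rpow_mul (by positivity), hpr,
        Real.mul_rpow (by positivity) hd0, ← mul_assoc] at h2
      calc _ ≤ _ := h2
        _ ≤ M ^ 2 * δ⁻¹ ^ M * d ^ p := by gcongr
        _ ≤ _ := le_add_of_nonneg_left (by positivity)
  have hsp : s ^ p ≤ 4 ^ M * 2 ^ M * (d ^ p + |b| ^ p) := by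
    have h1 : s ≤ 2 * (d + |b|) := by
      have : |a| ≤ d + |b| := by
        have := abs_add_le (a - b) b
        rwa [sub_add_cancel] at this
      linarith [abs_nonneg (a - b)]
    calc s ^ p ≤ (2 * (d + |b|)) ^ p := Real.rpow_le_rpow hs0 h1 (by linarith)
      _ = 2 ^ p * (d + |b|) ^ p := Real.mul_rpow (by norm_num) (by positivity)
      _ ≤ 4 ^ M * (2 ^ M * (d ^ p + |b| ^ p)) := by
        have e : (2 : ℝ) ^ p ≤ 4 ^ M :=
          (Real.rpow_le_rpow (by norm_num) (by norm_num) (by linarith)).trans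
            (Real.rpow_le_rpow_of_exponent_le (by norm_num : (1 : ℝ) ≤ 4) hM)
        exact mul_le_mul e (add_rpow_le_two_rpow_mul (by linarith) hM hd0 (abs_nonneg b))
          (by positivity) (by positivity)
      _ = _ := by ring
  have hdp : 0 ≤ d ^ p := by positivity
  calc _ ≤ _ := hmain
    _ ≤ M ^ 2 * δ * (4 ^ M * 2 ^ M * (d ^ p + |b| ^ p)) + M ^ 2 * δ⁻¹ ^ M * d ^ p := by gcongr
    _ = M ^ 2 * 4 ^ M * 2 ^ M * δ * |b| ^ p
        + (δ * (M ^ 2 * 4 ^ M * 2 ^ M) + M ^ 2 * δ⁻¹ ^ M) * d ^ p := by ring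
    _ ≤ _ := by
      have := mul_le_of_le_one_left (by positivity : 0 ≤ M ^ 2 * 4 ^ M * 2 ^ M) hδ1
      gcongr _ + (?_ + _) * _

lemma luxNorm_nonneg {N : ℕ} (Ω : Set (EuclideanSpace ℝ (Fin N)))
    (p w : EuclideanSpace ℝ (Fin N) → ℝ) : 0 ≤ luxNorm Ω p w :=
  Real.sInf_nonneg fun _ hα => hα.1.le

section Modular

variable {N : ℕ} {Ω : Set (EuclideanSpace ℝ (Fin N))} {p : EuclideanSpace ℝ (Fin N) → ℝ}

lemma ae_lt_of_nonneg_of_lt_essInf {c : ℝ} (hc : 0 ≤ c) (h : c < essInf p (volume.restrict Ω)) :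
    ∀ᵐ x ∂volume.restrict Ω, c < p x := by
  rw [essInf, liminf_eq] at h
  have hne : {a | ∀ᶠ x in ae (volume.restrict Ω), a ≤ p x}.Nonempty := by
    by_contra hemp
    rw [Set.not_nonempty_iff_eq_empty.1 hemp, Real.sSup_empty] at h
    linarith
  obtain ⟨a, ha, hca⟩ := exists_lt_of_lt_csSup hne h
  filter_upwards [ha] with x hx using hca.trans_le hx

/-- Integrating a pointwise bound by two modular densities. -/
lemma modular_le_add {q f g w : EuclideanSpace ℝ (Fin N) → ℝ} (hp : Measurable p)
    (hf : Measurable f) (hg : Measurable g) {A B : ℝ} (hA : 0 ≤ A) (hB : 0 ≤ B)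
    (h : ∀ᵐ x ∂volume.restrict Ω, |w x| ^ q x ≤ A * |f x| ^ p x + B * |g x| ^ p x) :
    modular Ω q w ≤ ENNReal.ofReal A * modular Ω p f + ENNReal.ofReal B * modular Ω p g := by
  have hmf : Measurable fun x => ENNReal.ofReal (|f x| ^ p x) := by fun_prop
  have hmg : Measurable fun x => ENNReal.ofReal (|g x| ^ p x) := by fun_prop
  unfold modular
  rw [← lintegral_const_mul _ hmf, ← lintegral_const_mul _ hmg,
    ← lintegral_add_left (hmf.const_mul _)]
  refine lintegral_mono_ae ?_
  filter_upwards [h] with x hx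
  rw [← ENNReal.ofReal_mul hA, ← ENNReal.ofReal_mul hB,
    ← ENNReal.ofReal_add (by positivity) (by positivity)]
  exact ENNReal.ofReal_le_ofReal hx

lemma modular_le_const_mul {q f w : EuclideanSpace ℝ (Fin N) → ℝ} (hp : Measurable p)
    (hf : Measurable f) {A : ℝ} (hA : 0 ≤ A)
    (h : ∀ᵐ x ∂volume.restrict Ω, |w x| ^ q x ≤ A * |f x| ^ p x) :
    modular Ω q w ≤ ENNReal.ofReal A * modular Ω p f := by
  simpa using modular_le_add (g := f) hp hf hf hA le_rfl (by simpa using h)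

lemma modular_sub_lt_top {f g : EuclideanSpace ℝ (Fin N) → ℝ} (hp : Measurable p)
    (hf : Measurable f) (hg : Measurable g) {M : ℝ}
    (hpM : ∀ᵐ x ∂volume.restrict Ω, 0 ≤ p x ∧ p x ≤ M)
    (hfp : modular Ω p f < ⊤) (hgp : modular Ω p g < ⊤) :
    modular Ω p (fun x => f x - g x) < ⊤ := by
  refine (modular_le_add (A := 2 ^ M) (B := 2 ^ M) hp hf hg (by positivity) (by positivity)
    ?_).trans_lt
    (ENNReal.add_lt_top.2 ⟨ENNReal.mul_lt_top ENNReal.ofReal_lt_top hfp,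
      ENNReal.mul_lt_top ENNReal.ofReal_lt_top hgp⟩)
  filter_upwards [hpM] with x hx
  rw [← mul_add]
  exact (Real.rpow_le_rpow (abs_nonneg _) (abs_sub _ _) hx.1).trans
    (add_rpow_le_two_rpow_mul hx.1 hx.2 (abs_nonneg _) (abs_nonneg _))

/-- For bounded exponents, a function of small Luxemburg norm has small modular. -/
lemma modular_le_of_luxNorm_lt {w : EuclideanSpace ℝ (Fin N) → ℝ} (hp : Measurable p)
    (hw : Measurable w) (hp1 : ∀ᵐ x ∂volume.restrict Ω, 1 ≤ p x)
    (hfin : modular Ω p w < ⊤) {ε : ℝ} (hε1 : ε ≤ 1) (h : luxNorm Ω p w < ε) :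
    modular Ω p w ≤ ENNReal.ofReal ε := by
  have hne : {α : ℝ | 0 < α ∧ (∫⁻ x in Ω, ENNReal.ofReal (|w x / α| ^ p x)) ≤ 1}.Nonempty := by
    set m := (modular Ω p w).toReal with hm
    have hm0 : 0 ≤ m := ENNReal.toReal_nonneg
    refine ⟨m + 1, by positivity, ?_⟩
    have hb : modular Ω p (fun x => w x / (m + 1)) ≤
        ENNReal.ofReal (m + 1)⁻¹ * modular Ω p w := by
      refine modular_le_const_mul hp hw (by positivity) ?_
      filter_upwards [hp1] with x hx
      rw [abs_div, abs_of_pos (by positivity : 0 < m + 1), div_eq_inv_mul,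
        Real.mul_rpow (by positivity) (abs_nonneg _)]
      gcongr
      simpa using Real.rpow_le_rpow_of_exponent_ge (by positivity : 0 < (m + 1)⁻¹)
        (inv_le_one_of_one_le₀ (by linarith)) hx
    refine hb.trans ?_
    rw [← ENNReal.ofReal_toReal hfin.ne, ← hm, ← ENNReal.ofReal_mul (by positivity)]
    refine ENNReal.ofReal_le_one.2 ?_
    rw [inv_mul_eq_div, div_le_one (by positivity)]
    linarith
  obtain ⟨α, ⟨hα, hαm⟩, hαε⟩ := exists_lt_of_csInf_lt hne h
  have hb : modular Ω p w ≤ ENNReal.ofReal α * modular Ω p (fun x => w x / α) := by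
    refine modular_le_const_mul hp (by fun_prop) hα.le ?_
    filter_upwards [hp1] with x hx
    have e : |w x| = α * |w x / α| := by
      rw [abs_div, abs_of_pos hα]; field_simp
    rw [e, Real.mul_rpow hα.le (abs_nonneg _)]
    simp only [abs_div, abs_of_pos hα]
    gcongr
    simpa using Real.rpow_le_rpow_of_exponent_ge hα (by linarith) hx
  calc _ ≤ _ := hb
    _ ≤ ENNReal.ofReal α * 1 := by gcongr; exact hαm
    _ ≤ ENNReal.ofReal ε := by
      rw [mul_one]; exact ENNReal.ofReal_le_ofReal hαε.le

/-- For exponents at most two, a function of small modular has small Luxemburg norm. -/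
lemma luxNorm_le_of_modular_le {w : EuclideanSpace ℝ (Fin N) → ℝ} (hp : Measurable p)
    (hw : Measurable w) (hp2 : ∀ᵐ x ∂volume.restrict Ω, p x ≤ 2) {α : ℝ} (hα : 0 < α)
    (hα1 : α ≤ 1) (h : modular Ω p w ≤ ENNReal.ofReal (α ^ 2)) : luxNorm Ω p w ≤ α := by
  refine csInf_le ⟨0, fun β hβ => hβ.1.le⟩ ⟨hα, ?_⟩
  have hb : modular Ω p (fun x => w x / α) ≤ ENNReal.ofReal (α⁻¹ ^ 2) * modular Ω p w := by
    refine modular_le_const_mul hp hw (by positivity) ?_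
    filter_upwards [hp2] with x hx
    rw [abs_div, abs_of_pos hα, div_eq_inv_mul, Real.mul_rpow (by positivity) (abs_nonneg _)]
    gcongr
    rw [← Real.rpow_two]
    exact Real.rpow_le_rpow_of_exponent_le ((one_le_inv₀ hα).2 hα1) hx
  calc _ ≤ _ := hb
    _ ≤ ENNReal.ofReal (α⁻¹ ^ 2) * ENNReal.ofReal (α ^ 2) := by gcongr
    _ = 1 := by
      rw [← ENNReal.ofReal_mul (by positivity), ← mul_pow, inv_mul_cancel₀ hα.ne']
      simp

end Modular

/-- (Continuity of the Nemytskii map `u ↦ |u|^{p(·)−2}u` from `L^{p(·)}(Ω)`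
to `L^{p(·)/(p(·)−1)}(Ω)` for `2 < p⁻ ≤ p⁺ < ∞`.) -/
theorem nemytskii_continuous {N : ℕ} (Ω : Set (EuclideanSpace ℝ (Fin N)))
    (hΩ : MeasurableSet Ω) (p : EuclideanSpace ℝ (Fin N) → ℝ) (hp : Measurable p)
    (hpm : 2 < essInf p (volume.restrict Ω))
    (hpM : ∃ C : ℝ, ∀ᵐ x ∂volume.restrict Ω, p x ≤ C)
    (u : ℕ → EuclideanSpace ℝ (Fin N) → ℝ) (v : EuclideanSpace ℝ (Fin N) → ℝ)
    (hu : ∀ n, Measurable (u n)) (huLp : ∀ n, modular Ω p (u n) < ⊤)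
    (hv : Measurable v) (hvLp : modular Ω p v < ⊤)
    (hconv : Tendsto (fun n => luxNorm Ω p (fun x => u n x - v x)) atTop (𝓝 0)) :
    Tendsto (fun n => luxNorm Ω (fun x => p x / (p x - 1))
      (fun x => |u n x| ^ (p x - 2) * u n x - |v x| ^ (p x - 2) * v x)) atTop (𝓝 0) := by
  obtain ⟨M, hM⟩ := hpM
  have hp2 : ∀ᵐ x ∂volume.restrict Ω, 2 < p x := ae_lt_of_nonneg_of_lt_essInf (by norm_num) hpm
  rw [Metric.tendsto_atTop']
  intro ε hε
  set α := min (ε / 2) 1 with hαdef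
  have hα : 0 < α := by positivity
  have hαε : α < ε := (min_le_left _ _).trans_lt (by linarith)
  set A : ℝ := M ^ 2 * 4 ^ M * 2 ^ M with hA
  have hA0 : 0 ≤ A := by positivity
  set V := (modular Ω p v).toReal with hV
  have hV0 : 0 ≤ V := ENNReal.toReal_nonneg
  set δ := min 1 (α ^ 2 / (2 * (A * V + 1))) with hδdef
  have hδ : 0 < δ := by positivity
  have hδ1 : δ ≤ 1 := min_le_left _ _
  have hδV : A * δ * V ≤ α ^ 2 / 2 := by
    have h1 : δ * (2 * (A * V + 1)) ≤ α ^ 2 :=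
      (le_div_iff₀ (by positivity)).1 (min_le_right _ _)
    nlinarith
  set B : ℝ := A + M ^ 2 * δ⁻¹ ^ M with hB
  have hB0 : 0 ≤ B := by positivity
  set η := min 1 (α ^ 2 / (2 * (B + 1))) with hηdef
  have hη : 0 < η := by positivity
  have hηB : B * η ≤ α ^ 2 / 2 := by
    have h1 : η * (2 * (B + 1)) ≤ α ^ 2 :=
      (le_div_iff₀ (by positivity)).1 (min_le_right _ _)
    nlinarith
  obtain ⟨n₀, hn₀⟩ := eventually_atTop.1 (hconv.eventually_lt_const hη)
  refine ⟨n₀, fun n hn => ?_⟩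
  have hd := modular_le_of_luxNorm_lt hp ((hu n).sub hv)
    (by filter_upwards [hp2] with x hx using by linarith)
    (modular_sub_lt_top (M := M) hp (hu n) hv
      (by filter_upwards [hp2, hM] with x hx hxM using ⟨by linarith, hxM⟩) (huLp n) hvLp)
    (min_le_left _ _) (hn₀ n hn.le)
  have hmod : modular Ω (fun x => p x / (p x - 1))
      (fun x => |u n x| ^ (p x - 2) * u n x - |v x| ^ (p x - 2) * v x) ≤
      ENNReal.ofReal (α ^ 2) := by
    refine (modular_le_add (A := A * δ) (B := B) hp hv ((hu n).sub hv) (by positivity) hB0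
      ?_).trans ?_
    · filter_upwards [hp2, hM] with x hx hxM
      exact abs_signedPow_sub_rpow_conj_le hx hxM hδ hδ1 (u n x) (v x)
    · calc _ ≤ ENNReal.ofReal (A * δ) * ENNReal.ofReal V
            + ENNReal.ofReal B * ENNReal.ofReal η := by
            rw [hV, ENNReal.ofReal_toReal hvLp.ne]
            gcongr
        _ = ENNReal.ofReal (A * δ * V + B * η) := by
            rw [← ENNReal.ofReal_mul (by positivity), ← ENNReal.ofReal_mul hB0,
              ← ENNReal.ofReal_add (by positivity) (by positivity)]
        _ ≤ _ := ENNReal.ofReal_le_ofReal (by linarith)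
  have hun := hu n
  have hle := luxNorm_le_of_modular_le (by fun_prop) (by fun_prop)
    (by
      filter_upwards [hp2] with x hx
      rw [div_le_iff₀ (by linarith)]
      linarith) hα (min_le_right _ _) hmod
  rw [Real.dist_eq, sub_zero, abs_of_nonneg (luxNorm_nonneg _ _ _)]
  exact hle.trans_lt hαε
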